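/- Let (a_n) be a strictly increasing sequence of positive real numbers with a_1 ≥ 1. The linear span of the monomials {1, x^{a_1}, x^{a_2}, ...} is dense in C([0,1]) (with the sup norm) if and only if Σ_n 1/a_n = ∞. -/

import Mathlib

open Set

/-- The monomial `x ^ |s|` as a continuous function on `[0,1]`; the absolute value makes it
continuous for every real `s`. -/
noncomputable def muntzMonomial (s : ℝ) : C(Set.Icc (0:ℝ) 1, ℝ) where
  toFun x := (x : ℝ) ^ |s|
  continuous_toFun := (Real.continuous_rpow_const (abs_nonneg s)).comp continuous_subtype_val

lemma muntzMonomial_apply {s : ℝ} (hs : 0 ≤ s) (x : Set.Icc (0:ℝ) 1) :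
    muntzMonomial s x = (x : ℝ) ^ s := by
  simp [muntzMonomial, abs_of_nonneg hs]

/-- A solution of the Euler equation `x F' = a F - (a - q) f` with `F 1 = 0` is bounded below
in terms of a bound of `f`. -/
lemma neg_le_of_euler_equation {F D f : ℝ → ℝ} {a q M : ℝ} (ha : 0 < a) (hM : 0 ≤ M)
    (hF1 : F 1 = 0) (hD : ∀ x, 0 < x → HasDerivAt F (D x) x)
    (hode : ∀ x, 0 < x → x * D x = a * F x - (a - q) * f x)
    (hf : ∀ x, 0 < x → x ≤ 1 → |f x| ≤ M) {x : ℝ} (hx : 0 < x) (hx1 : x ≤ 1) :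
    -(|1 - q / a| * M) ≤ F x := by
  set K := |1 - q / a| * M with hK
  have hK0 : 0 ≤ K := by positivity
  have haK : a * K = |a - q| * M := by
    have : a - q = a * (1 - q / a) := by field_simp
    rw [hK, this, abs_mul, abs_of_pos ha, mul_assoc]
  have hG : ∀ y, 0 < y → HasDerivAt (fun y => y ^ (-a) * (F y + K))
      ((-a) * y ^ (-a - 1) * (F y + K) + y ^ (-a) * D y) y := fun y hy =>
    (Real.hasDerivAt_rpow_const (Or.inl hy.ne')).mul ((hD y hy).add_const K)
  have hanti : AntitoneOn (fun y => y ^ (-a) * (F y + K)) (Ioc 0 1) := by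
    apply antitoneOn_of_deriv_nonpos (convex_Ioc 0 1)
    · exact fun y hy => (hG y hy.1).continuousAt.continuousWithinAt
    · intro y hy
      rw [interior_Ioc] at hy
      exact (hG y hy.1).differentiableAt.differentiableWithinAt
    · intro y hy
      rw [interior_Ioc] at hy
      rw [(hG y hy.1).deriv]
      have hpow : y ^ (-a) = y ^ (-a - 1) * y := by
        rw [← Real.rpow_add_one hy.1.ne']; congr 1; ring
      have hfac : (-a) * y ^ (-a - 1) * (F y + K) + y ^ (-a) * D y
          = y ^ (-a - 1) * (-(a - q) * f y - a * K) := by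
        rw [hpow]
        linear_combination y ^ (-a - 1) * hode y hy.1
      rw [hfac]
      have hbound : |-(a - q) * f y| ≤ |a - q| * M := by
        rw [abs_mul, abs_neg]
        exact mul_le_mul_of_nonneg_left (hf y hy.1 hy.2.le) (abs_nonneg _)
      apply mul_nonpos_of_nonneg_of_nonpos (Real.rpow_pos_of_pos hy.1 _).le
      linarith [le_abs_self (-(a - q) * f y)]
  have h := hanti ⟨hx, hx1⟩ ⟨one_pos, le_rfl⟩ hx1
  simp only [Real.one_rpow, hF1] at h
  have hpos := nonneg_of_mul_nonneg_right (show 0 ≤ x ^ (-a) * (F x + K) by linarith)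
    (Real.rpow_pos_of_pos hx _)
  linarith

lemma abs_le_of_euler_equation {F D f : ℝ → ℝ} {a q M : ℝ} (ha : 0 < a) (hM : 0 ≤ M)
    (hF1 : F 1 = 0) (hD : ∀ x, 0 < x → HasDerivAt F (D x) x)
    (hode : ∀ x, 0 < x → x * D x = a * F x - (a - q) * f x)
    (hf : ∀ x, 0 < x → x ≤ 1 → |f x| ≤ M) {x : ℝ} (hx : 0 < x) (hx1 : x ≤ 1) :
    |F x| ≤ |1 - q / a| * M := by
  refine abs_le.2 ⟨neg_le_of_euler_equation ha hM hF1 hD hode hf hx hx1, ?_⟩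
  have h := neg_le_of_euler_equation (F := fun x => -F x) (D := fun x => -D x)
    (f := fun x => -f x) (q := q) ha hM (by simp [hF1]) (fun y hy => (hD y hy).neg)
    (fun y hy => by linear_combination -hode y hy)
    (fun y hy hy1 => by rw [abs_neg]; exact hf y hy hy1) hx hx1
  linarith

/-- Von Golitschek's construction of approximations to `x ^ q`. -/
lemma exists_muntz_approximation {b : ℕ → ℝ} (hb : ∀ n, 0 < b n)
    (hinj : Function.Injective b) {q : ℝ} (hq : 0 < q) (n : ℕ) :
    ∃ c : ℕ → ℝ, ∀ x : ℝ, 0 < x → x ≤ 1 →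
      |x ^ q - ∑ k ∈ Finset.range n, c k * x ^ b k|
        ≤ ∏ k ∈ Finset.range n, |1 - q / b k| := by
  induction n with
  | zero =>
    refine ⟨0, fun x hx hx1 => ?_⟩
    simpa [abs_of_pos (Real.rpow_pos_of_pos hx q)] using Real.rpow_le_one hx.le hx1 hq.le
  | succ n ih =>
    obtain ⟨c, hc⟩ := ih
    let d : ℕ → ℝ := fun k => c k * (b n - q) / (b k - b n)
    have hne : ∀ k ∈ Finset.range n, b k - b n ≠ 0 := fun k hk =>
      sub_ne_zero.2 (hinj.ne (Finset.mem_range.1 hk).ne)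
    refine ⟨fun k => if k < n then -d k else 1 + ∑ j ∈ Finset.range n, d j, fun x hx hx1 => ?_⟩
    have hsum : ∑ k ∈ Finset.range (n + 1),
        (if k < n then -d k else 1 + ∑ j ∈ Finset.range n, d j) * x ^ b k
        = (1 + ∑ j ∈ Finset.range n, d j) * x ^ b n
          - ∑ k ∈ Finset.range n, d k * x ^ b k := by
      rw [Finset.sum_range_succ, if_neg (lt_irrefl n), add_comm, sub_eq_add_neg,
        ← Finset.sum_neg_distrib]
      congr 1
      refine Finset.sum_congr rfl fun k hk => ?_
      rw [if_pos (Finset.mem_range.1 hk), neg_mul]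
    rw [hsum, Finset.prod_range_succ,
      mul_comm (∏ k ∈ Finset.range n, |1 - q / b k|)]
    refine abs_le_of_euler_equation
      (F := fun x => x ^ q - ((1 + ∑ j ∈ Finset.range n, d j) * x ^ b n
          - ∑ k ∈ Finset.range n, d k * x ^ b k))
      (D := fun x => q * x ^ (q - 1)
        - ((1 + ∑ j ∈ Finset.range n, d j) * (b n * x ^ (b n - 1))
          - ∑ k ∈ Finset.range n, d k * (b k * x ^ (b k - 1))))
      (hb n) (Finset.prod_nonneg fun _ _ => abs_nonneg _) (by simp) ?_ ?_ hc hx hx1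
    · intro y hy
      have hmon : ∀ s : ℝ, HasDerivAt (fun y : ℝ => y ^ s) (s * y ^ (s - 1)) y := fun s =>
        Real.hasDerivAt_rpow_const (Or.inl hy.ne')
      exact (hmon q).sub (((hmon _).const_mul _).sub
        (HasDerivAt.fun_sum fun k _ => (hmon (b k)).const_mul (d k)))
    · intro y hy
      have hmon : ∀ s : ℝ, y * y ^ (s - 1) = y ^ s := fun s => by
        rw [mul_comm, ← Real.rpow_add_one hy.ne']; congr 1; ring
      have hS : ∑ k ∈ Finset.range n, d k * (b k * y ^ b k)
          = b n * ∑ k ∈ Finset.range n, d k * y ^ b k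
            + (b n - q) * ∑ k ∈ Finset.range n, c k * y ^ b k := by
        rw [Finset.mul_sum, Finset.mul_sum, ← Finset.sum_add_distrib]
        refine Finset.sum_congr rfl fun k hk => ?_
        have hdk : d k * (b k - b n) = c k * (b n - q) := div_mul_cancel₀ _ (hne k hk)
        linear_combination y ^ b k * hdk
      have hyS : y * ∑ k ∈ Finset.range n, d k * (b k * y ^ (b k - 1))
          = ∑ k ∈ Finset.range n, d k * (b k * y ^ b k) := by
        rw [Finset.mul_sum]
        refine Finset.sum_congr rfl fun k _ => ?_
        linear_combination d k * b k * hmon (b k)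
      linear_combination q * hmon q
        - (1 + ∑ j ∈ Finset.range n, d j) * b n * hmon (b n) + hyS + hS

lemma muntzMonomial_mem_of_tendsto_prod {V : Submodule ℝ C(Set.Icc (0:ℝ) 1, ℝ)}
    (hV : IsClosed (V : Set C(Set.Icc (0:ℝ) 1, ℝ))) {b : ℕ → ℝ} (hb : ∀ n, 0 < b n)
    (hinj : Function.Injective b) (hmem : ∀ n, muntzMonomial (b n) ∈ V) {q : ℝ} (hq : 0 < q)
    (hprod : Filter.Tendsto (fun n => ∏ k ∈ Finset.range n, |1 - q / b k|)
      Filter.atTop (nhds 0)) :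
    muntzMonomial q ∈ V := by
  choose c hc using exists_muntz_approximation hb hinj hq
  refine hV.mem_of_tendsto (b := Filter.atTop)
    (f := fun n => ∑ k ∈ Finset.range n, c n k • muntzMonomial (b k)) ?_
    (Filter.Eventually.of_forall fun n => V.sum_mem fun k _ => V.smul_mem _ (hmem k))
  rw [tendsto_iff_dist_tendsto_zero]
  refine squeeze_zero (fun _ => dist_nonneg) (fun n => ?_) hprod
  have hP : 0 ≤ ∏ k ∈ Finset.range n, |1 - q / b k| :=
    Finset.prod_nonneg fun _ _ => abs_nonneg _
  rw [dist_comm, ContinuousMap.dist_le hP]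
  rintro ⟨x, hx0, hx1⟩
  rw [Real.dist_eq]
  simp only [ContinuousMap.coe_sum, Finset.sum_apply, ContinuousMap.coe_smul, Pi.smul_apply,
    smul_eq_mul, muntzMonomial_apply hq.le, muntzMonomial_apply (hb _).le]
  rcases hx0.eq_or_lt with rfl | hx
  · simpa [Real.zero_rpow hq.ne', Real.zero_rpow (hb _).ne'] using hP
  · exact hc n x hx hx1

lemma muntzMonomial_mem_of_lt_three_halves {V : Submodule ℝ C(Set.Icc (0:ℝ) 1, ℝ)}
    (hV : IsClosed (V : Set C(Set.Icc (0:ℝ) 1, ℝ))) {r : ℝ}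
    (h : ∀ q, 0 < q → q < r → muntzMonomial q ∈ V) {q : ℝ} (hq : 0 < q)
    (hqr : q < 3 / 2 * r) : muntzMonomial q ∈ V := by
  rcases lt_or_ge q r with hlt | hge
  · exact h q hq hlt
  have hr : 0 < r := by linarith
  have hn : ∀ n : ℕ, 0 < 1 / ((n : ℝ) + 8) ∧ 1 / ((n : ℝ) + 8) ≤ 1 / 8 := fun n =>
    ⟨by positivity, one_div_le_one_div_of_le (by norm_num) (by simp)⟩
  have hb : ∀ n : ℕ, 7 / 8 * r ≤ r * (1 - 1 / ((n : ℝ) + 8)) := fun n => by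
    nlinarith [hn n]
  have hb' : ∀ n : ℕ, r * (1 - 1 / ((n : ℝ) + 8)) < r := fun n => by
    nlinarith [hn n]
  refine muntzMonomial_mem_of_tendsto_prod hV (b := fun n : ℕ => r * (1 - 1 / ((n : ℝ) + 8)))
    (fun n => by linarith [hb n]) ?_ (fun n => h _ (by linarith [hb n]) (hb' n)) hq ?_
  · intro m n hmn
    simpa [hr.ne'] using hmn
  · refine squeeze_zero (fun n => Finset.prod_nonneg fun _ _ => abs_nonneg _) (fun n => ?_)
      (tendsto_pow_atTop_nhds_zero_of_lt_one (r := (5 / 7 : ℝ)) (by norm_num) (by norm_num))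
    calc _ ≤ ∏ _k ∈ Finset.range n, (5 / 7 : ℝ) := by
          refine Finset.prod_le_prod (fun _ _ => abs_nonneg _) fun k _ => ?_
          have hbk : 0 < r * (1 - 1 / ((k : ℝ) + 8)) := by linarith [hb k]
          have h1 : q / (r * (1 - 1 / ((k : ℝ) + 8))) ≤ 12 / 7 := by
            rw [div_le_iff₀ hbk]; linarith [hb k]
          have h2 : 1 ≤ q / (r * (1 - 1 / ((k : ℝ) + 8))) := by
            rw [le_div_iff₀ hbk]; linarith [hb' k]
          rw [abs_le]; constructor <;> linarith
      _ = _ := by rw [Finset.prod_const, Finset.card_range]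

lemma eq_top_of_muntzMonomial_mem {V : Submodule ℝ C(Set.Icc (0:ℝ) 1, ℝ)}
    (hV : IsClosed (V : Set C(Set.Icc (0:ℝ) 1, ℝ))) (h0 : (1 : C(Set.Icc (0:ℝ) 1, ℝ)) ∈ V)
    (h : ∀ q, 0 < q → q < 1 → muntzMonomial q ∈ V) : V = ⊤ := by
  have hpow : ∀ n : ℕ, ∀ q, 0 < q → q < (3 / 2 : ℝ) ^ n → muntzMonomial q ∈ V := by
    intro n
    induction n with
    | zero => simpa using h
    | succ n ih =>
      intro q hq hqn
      exact muntzMonomial_mem_of_lt_three_halves hV ih hq (by rwa [pow_succ'] at hqn)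
  have hall : ∀ q, 0 < q → muntzMonomial q ∈ V := fun q hq => by
    obtain ⟨n, hn⟩ := pow_unbounded_of_one_lt q (show (1 : ℝ) < 3 / 2 by norm_num)
    exact hpow n q hq hn
  have hpoly : (polynomialFunctions (Set.Icc (0:ℝ) 1) : Set C(Set.Icc (0:ℝ) 1, ℝ)) ⊆ V := by
    rintro _ ⟨p, -, rfl⟩
    induction p using Polynomial.induction_on' with
    | add p q hp hq =>
      simp only [map_add] at *
      exact V.add_mem hp hq
    | monomial n c =>
      rcases Nat.eq_zero_or_pos n with rfl | hn
      · have heq : Polynomial.toContinuousMapOnAlgHom (Set.Icc (0:ℝ) 1)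
            (Polynomial.monomial 0 c) = c • 1 := by ext x; simp
        exact Set.mem_of_eq_of_mem heq (V.smul_mem c h0)
      · have heq : Polynomial.toContinuousMapOnAlgHom (Set.Icc (0:ℝ) 1)
            (Polynomial.monomial n c) = c • muntzMonomial n := by
          ext x; simp [muntzMonomial_apply]
        exact Set.mem_of_eq_of_mem heq (V.smul_mem c (hall n (by exact_mod_cast hn)))
  have htop := polynomialFunctions_closure_eq_top (0 : ℝ) 1
  rw [eq_top_iff]
  intro f _
  have hf : f ∈ (polynomialFunctions (Set.Icc (0:ℝ) 1)).topologicalClosure := by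
    rw [htop]; trivial
  exact closure_minimal hpoly hV hf

/-- The Gram form of the monomials `x ^ s`, `s ∈ S`, in `L²(0,1)`. -/
noncomputable def muntzGram (S : Finset ℝ) (c : ℝ → ℝ) : ℝ :=
  ∑ s ∈ S, ∑ t ∈ S, c s * c t / (s + t + 1)

/-- Multiplying the coefficient of `x ^ s` by the Blaschke factor `(s - a) / (s + a + 1)` is a
contraction for the Gram form. -/
lemma muntzGram_blaschke_le {S : Finset ℝ} (hS : ∀ s ∈ S, 0 ≤ s) (c : ℝ → ℝ) {a : ℝ}
    (ha : 0 ≤ a) : muntzGram S (fun s => (s - a) / (s + a + 1) * c s) ≤ muntzGram S c := by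
  have h : muntzGram S (fun s => (s - a) / (s + a + 1) * c s)
      = muntzGram S c - (2 * a + 1) * (∑ s ∈ S, c s / (s + a + 1)) ^ 2 := by
    rw [sq, Finset.sum_mul_sum, Finset.mul_sum]
    simp only [muntzGram]
    rw [← Finset.sum_sub_distrib]
    refine Finset.sum_congr rfl fun s hs => ?_
    rw [Finset.mul_sum, ← Finset.sum_sub_distrib]
    refine Finset.sum_congr rfl fun t ht => ?_
    have hs0 := hS s hs
    have ht0 := hS t ht
    have h1 : s + a + 1 ≠ 0 := by positivity
    have h2 : t + a + 1 ≠ 0 := by positivity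
    have h3 : s + t + 1 ≠ 0 := by positivity
    field_simp
    ring
  rw [h]
  have : 0 ≤ (2 * a + 1) * (∑ s ∈ S, c s / (s + a + 1)) ^ 2 := by positivity
  linarith

lemma le_muntzGram {q : ℝ} (hq : 0 ≤ q) {T : Finset ℝ} (hT : ∀ s ∈ T, 0 ≤ s) (hqT : q ∉ T)
    (c : ℝ → ℝ) :
    (c q * ∏ a ∈ T, (q - a) / (q + a + 1)) ^ 2 / (2 * q + 1)
      ≤ muntzGram (insert q T) c := by
  induction T using Finset.induction_on generalizing c with
  | empty => simp [muntzGram, sq, two_mul]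
  | insert a T haT ih =>
    have ha : 0 ≤ a := hT a (Finset.mem_insert_self a T)
    have hT' : ∀ s ∈ T, 0 ≤ s := fun s hs => hT s (Finset.mem_insert_of_mem hs)
    have hqa : a ≠ q := fun h => hqT (h ▸ Finset.mem_insert_self a T)
    have hqT' : q ∉ T := fun h => hqT (Finset.mem_insert_of_mem h)
    have hnotin : a ∉ insert q T := by simp [hqa, haT]
    refine le_trans ?_ (muntzGram_blaschke_le (a := a) ?_ c ha)
    · have hdrop : muntzGram (insert q (insert a T)) (fun s => (s - a) / (s + a + 1) * c s)
          = muntzGram (insert q T) (fun s => (s - a) / (s + a + 1) * c s) := by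
        rw [Finset.insert_comm]
        simp [muntzGram, Finset.sum_insert hnotin]
      rw [hdrop]
      refine le_trans (le_of_eq ?_) (ih hT' hqT' _)
      rw [Finset.prod_insert haT]
      ring
    · intro s hs
      rcases Finset.mem_insert.1 hs with rfl | hs
      exacts [hq, hT s hs]

lemma muntzGram_eq_integral {S : Finset ℝ} (hS : ∀ s ∈ S, 0 ≤ s) (c : ℝ → ℝ) :
    muntzGram S c = ∫ x in (0:ℝ)..1, (∑ s ∈ S, c s * x ^ s) ^ 2 := by
  have hint : ∀ s ∈ S, ∀ t ∈ S, IntervalIntegrable (fun x : ℝ => c s * x ^ s * (c t * x ^ t))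
      MeasureTheory.volume 0 1 := fun s hs t ht =>
    (((Real.continuous_rpow_const (hS s hs)).const_mul _).mul
      ((Real.continuous_rpow_const (hS t ht)).const_mul _)).intervalIntegrable 0 1
  simp_rw [sq, Finset.sum_mul_sum]
  rw [intervalIntegral.integral_finsetSum fun s hs => by
    simpa only [Finset.sum_fn] using IntervalIntegrable.sum S (hint s hs)]
  refine Finset.sum_congr rfl fun s hs => ?_
  rw [intervalIntegral.integral_finsetSum (hint s hs)]
  refine Finset.sum_congr rfl fun t ht => ?_
  have hs0 := hS s hs
  have ht0 := hS t ht
  have hcongr : ∫ x in (0:ℝ)..1, c s * x ^ s * (c t * x ^ t)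
      = ∫ x in (0:ℝ)..1, c s * c t * x ^ (s + t) := by
    refine intervalIntegral.integral_congr fun x hx => ?_
    rw [uIcc_of_le zero_le_one] at hx
    rw [Real.rpow_add_of_nonneg hx.1 hs0 ht0]
    ring
  rw [hcongr, intervalIntegral.integral_const_mul, integral_rpow (Or.inl (by linarith)),
    Real.one_rpow, Real.zero_rpow (by positivity)]
  ring

lemma muntzGram_le_norm_sq {S : Finset ℝ} (hS : ∀ s ∈ S, 0 ≤ s) (c : ℝ → ℝ) :
    muntzGram S c ≤ ‖∑ s ∈ S, c s • muntzMonomial s‖ ^ 2 := by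
  rw [muntzGram_eq_integral hS]
  set N := ‖∑ s ∈ S, c s • muntzMonomial s‖
  have hcont : Continuous fun x : ℝ => (∑ s ∈ S, c s * x ^ s) ^ 2 :=
    (continuous_finsetSum S fun s hs =>
      (Real.continuous_rpow_const (hS s hs)).const_mul (c s)).pow 2
  calc _ ≤ ∫ _x in (0:ℝ)..1, N ^ 2 := by
        refine intervalIntegral.integral_mono_on zero_le_one (hcont.intervalIntegrable 0 1)
          (continuous_const.intervalIntegrable 0 1) fun x hx => ?_
        have h := (∑ s ∈ S, c s • muntzMonomial s).norm_coe_le_norm ⟨x, hx⟩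
        have hval : (∑ s ∈ S, c s • muntzMonomial s) ⟨x, hx⟩ = ∑ s ∈ S, c s * x ^ s := by
          simp only [ContinuousMap.coe_sum, Finset.sum_apply, ContinuousMap.coe_smul,
            Pi.smul_apply, smul_eq_mul]
          exact Finset.sum_congr rfl fun s hs => by rw [muntzMonomial_apply (hS s hs)]
        rw [hval, Real.norm_eq_abs] at h
        exact sq_le_sq' (abs_le.1 h).1 (abs_le.1 h).2
    _ = N ^ 2 := by simp

/-- The distance from `x ^ q` to a finite Müntz space is bounded below by the corresponding
Blaschke product. -/
lemma prod_blaschke_sq_le_dist_sq {q : ℝ} (hq : 0 ≤ q) {T : Finset ℝ} (hT : ∀ s ∈ T, 0 ≤ s)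
    (hqT : q ∉ T) (c : ℝ → ℝ) :
    (∏ a ∈ T, (q - a) / (q + a + 1)) ^ 2 / (2 * q + 1)
      ≤ dist (muntzMonomial q) (∑ s ∈ T, c s • muntzMonomial s) ^ 2 := by
  let d : ℝ → ℝ := fun s => if s = q then 1 else -c s
  have hS : ∀ s ∈ insert q T, 0 ≤ s := fun s hs => by
    rcases Finset.mem_insert.1 hs with rfl | hs
    exacts [hq, hT s hs]
  have h := (le_muntzGram hq hT hqT d).trans (muntzGram_le_norm_sq hS d)
  have hsum : ∑ s ∈ insert q T, d s • muntzMonomial s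
      = muntzMonomial q - ∑ s ∈ T, c s • muntzMonomial s := by
    rw [Finset.sum_insert hqT, sub_eq_add_neg, ← Finset.sum_neg_distrib]
    congr 1
    · simp [d]
    · refine Finset.sum_congr rfl fun s hs => ?_
      have : s ≠ q := fun h => hqT (h ▸ hs)
      simp [d, this]
  rwa [hsum, ← dist_eq_norm, show d q = 1 from if_pos rfl, one_mul] at h

lemma exp_neg_le_blaschke_half {a : ℝ} (ha : 1 ≤ a) :
    Real.exp (-(10 * (1 / a))) ≤ |((1:ℝ) / 2 - a) / (1 / 2 + a + 1)| := by
  have hden : 0 < 1 / 2 + a + 1 := by linarith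
  rw [abs_div, abs_of_pos hden, abs_of_neg (by linarith), Real.exp_neg,
    inv_le_comm₀ (Real.exp_pos _) (div_pos (by linarith) hden), inv_div]
  refine le_trans ?_ (Real.add_one_le_exp _)
  rw [div_le_iff₀ (by linarith)]
  have h : 0 < 1 / a ∧ a * (1 / a) = 1 := ⟨by positivity, by field_simp⟩
  have : 1 / a ≤ 1 := by rw [div_le_one (by linarith)]; exact ha
  nlinarith

lemma exp_neg_le_prod_blaschke_half {a : ℕ → ℝ} (hinj : Function.Injective a)
    (ha : ∀ n, 1 ≤ a n) (hsum : Summable fun n => 1 / a n) {T : Finset ℝ}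
    (hT : ∀ s ∈ T, s ∈ ({0} ∪ range a : Set ℝ)) :
    1 / 3 * Real.exp (-(10 * ∑' n, 1 / a n))
      ≤ |∏ s ∈ T, ((1:ℝ) / 2 - s) / (1 / 2 + s + 1)| := by
  have hexp : ∀ U : Finset ℝ, (∀ s ∈ U, s ∈ range a) →
      Real.exp (-(10 * ∑' n, 1 / a n))
        ≤ ∏ s ∈ U, |((1:ℝ) / 2 - s) / (1 / 2 + s + 1)| := by
    intro U hU
    obtain ⟨N, rfl⟩ : ∃ N : Finset ℕ, N.image a = U := by
      obtain ⟨N, -, hN⟩ := Finset.subset_set_image_iff.1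
        (show (U : Set ℝ) ⊆ a '' univ by rw [image_univ]; exact hU)
      exact ⟨N, hN⟩
    rw [Finset.prod_image hinj.injOn]
    refine le_trans ?_ (Finset.prod_le_prod (fun _ _ => (Real.exp_pos _).le)
      fun n _ => exp_neg_le_blaschke_half (ha n))
    rw [← Real.exp_sum, Real.exp_le_exp, Finset.sum_neg_distrib, ← Finset.mul_sum]
    have := hsum.sum_le_tsum N fun n _ => one_div_nonneg.2 (zero_le_one.trans (ha n))
    linarith
  rw [Finset.abs_prod]
  have hpos := Real.exp_pos (-(10 * ∑' n, 1 / a n))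
  by_cases h0 : (0 : ℝ) ∈ T
  · rw [← Finset.mul_prod_erase T _ h0]
    refine mul_le_mul (by norm_num) (hexp _ fun s hs => ?_) hpos.le (abs_nonneg _)
    exact (hT s (Finset.mem_of_mem_erase hs)).resolve_left (Finset.ne_of_mem_erase hs)
  · refine le_trans (by linarith) (hexp T fun s hs => (hT s hs).resolve_left ?_)
    rintro rfl
    exact h0 hs

lemma not_dense_span_of_summable {a : ℕ → ℝ} (hinj : Function.Injective a)
    (ha : ∀ n, 1 ≤ a n) (hsum : Summable fun n => 1 / a n) :
    ¬ Dense (Submodule.span ℝ (muntzMonomial '' ({0} ∪ range a)) :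
      Set C(Set.Icc (0:ℝ) 1, ℝ)) := by
  intro hdense
  set δ := 1 / 3 * Real.exp (-(10 * ∑' n, 1 / a n))
  have hδ0 : 0 < δ := by positivity
  obtain ⟨g, hg, hdist⟩ := Metric.dense_iff.1 hdense (muntzMonomial (1 / 2)) (δ / 2) (by positivity)
  obtain ⟨l, hl, rfl⟩ := (Finsupp.mem_span_image_iff_linearCombination ℝ).1 hdist
  have hmem : ∀ s ∈ l.support, s ∈ ({0} ∪ range a : Set ℝ) := fun s hs => hl hs
  have hnonneg : ∀ s ∈ l.support, 0 ≤ s := fun s hs => by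
    rcases hmem s hs with h | ⟨n, rfl⟩
    exacts [(mem_singleton_iff.1 h).ge, zero_le_one.trans (ha n)]
  have hhalf : (1 / 2 : ℝ) ∉ l.support := fun h => by
    rcases hmem _ h with h | ⟨n, hn⟩
    · norm_num at h
    · linarith [ha n]
  have hle := prod_blaschke_sq_le_dist_sq (by norm_num) hnonneg hhalf l
  rw [Metric.mem_ball, dist_comm, Finsupp.linearCombination_apply, Finsupp.sum] at hg
  have hprod := exp_neg_le_prod_blaschke_half hinj ha hsum hmem
  have h1 := pow_le_pow_left₀ hδ0.le hprod 2
  rw [sq_abs] at h1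
  have h2 := pow_lt_pow_left₀ hg dist_nonneg two_ne_zero
  have h3 : 0 < δ ^ 2 := by positivity
  linarith

lemma tendsto_prod_one_sub_div {a : ℕ → ℝ} (ha : ∀ n, 1 ≤ a n)
    (hsum : ¬ Summable fun n => 1 / a n) {q : ℝ} (hq : 0 < q) (hq1 : q < 1) :
    Filter.Tendsto (fun n => ∏ k ∈ Finset.range n, |1 - q / a k|) Filter.atTop (nhds 0) := by
  have hdiv := (not_summable_iff_tendsto_nat_atTop_of_nonneg
    fun n => one_div_nonneg.2 (zero_le_one.trans (ha n))).1 hsum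
  refine squeeze_zero (fun n => Finset.prod_nonneg fun _ _ => abs_nonneg _) (fun n => ?_)
    (Real.tendsto_exp_neg_atTop_nhds_zero.comp (hdiv.const_mul_atTop hq))
  rw [Function.comp_apply, Finset.mul_sum, ← Finset.sum_neg_distrib, Real.exp_sum]
  refine Finset.prod_le_prod (fun _ _ => abs_nonneg _) fun k _ => ?_
  have hk : q / a k ≤ 1 := by
    rw [div_le_one (by linarith [ha k])]
    linarith [ha k]
  rw [abs_of_nonneg (by linarith)]
  have := Real.add_one_le_exp (-(q * (1 / a k)))
  rw [mul_one_div] at this ⊢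
  linarith

lemma dense_span_of_not_summable {a : ℕ → ℝ} (hinj : Function.Injective a)
    (ha : ∀ n, 1 ≤ a n) (hsum : ¬ Summable fun n => 1 / a n) :
    Dense (Submodule.span ℝ (muntzMonomial '' ({0} ∪ range a)) :
      Set C(Set.Icc (0:ℝ) 1, ℝ)) := by
  have hmem : ∀ s ∈ ({0} ∪ range a : Set ℝ), muntzMonomial s ∈
      (Submodule.span ℝ (muntzMonomial '' ({0} ∪ range a))).topologicalClosure := fun s hs =>
    Submodule.le_topologicalClosure _ (Submodule.subset_span (mem_image_of_mem _ hs))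
  rw [Submodule.dense_iff_topologicalClosure_eq_top]
  have hclosed := Submodule.isClosed_topologicalClosure
    (Submodule.span ℝ (muntzMonomial '' ({0} ∪ range a)))
  refine eq_top_of_muntzMonomial_mem hclosed ?_ fun q hq hq1 =>
    muntzMonomial_mem_of_tendsto_prod hclosed (fun n => one_pos.trans_le (ha n)) hinj
      (fun n => hmem _ (Or.inr (mem_range_self n))) hq (tendsto_prod_one_sub_div ha hsum hq hq1)
  convert hmem 0 (Or.inl rfl) using 1
  ext x
  simp [muntzMonomial_apply]

/-- The Müntz approximation theorem: for a strictly increasing sequence of positive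
exponents `a` with `a 0 ≥ 1`, the span of `{1, x^(a 0), x^(a 1), …}` is dense in
`C([0,1])` iff `∑ 1 / a n = ∞`. -/
theorem muntz_theorem (a : ℕ → ℝ) (hpos : ∀ n, 0 < a n) (hmono : StrictMono a)
    (h1 : 1 ≤ a 0) :
    Dense (Submodule.span ℝ
        ({(1 : C(Set.Icc (0:ℝ) 1, ℝ))} ∪
          Set.range (fun n : ℕ =>
            ContinuousMap.mk (fun x : Set.Icc (0:ℝ) 1 => (x : ℝ) ^ (a n))
              (by
                exact Continuous.comp
                  (Real.continuous_rpow_const (hpos n).le) continuous_subtype_val)))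
        : Set C(Set.Icc (0:ℝ) 1, ℝ)) ↔ ¬ Summable (fun n => 1 / a n) := by
  have ha : ∀ n, 1 ≤ a n := fun n => h1.trans (hmono.monotone (Nat.zero_le n))
  have hset : ({(1 : C(Set.Icc (0:ℝ) 1, ℝ))} ∪
      Set.range (fun n : ℕ =>
        ContinuousMap.mk (fun x : Set.Icc (0:ℝ) 1 => (x : ℝ) ^ (a n))
          (by
            exact Continuous.comp
              (Real.continuous_rpow_const (hpos n).le) continuous_subtype_val)))
      = muntzMonomial '' ({0} ∪ range a) := by
    rw [image_union, image_singleton, ← range_comp]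
    congr 2
    · ext x
      simp [muntzMonomial_apply]
    · funext n
      ext x
      simp [muntzMonomial_apply (hpos n).le]
  rw [hset]
  exact ⟨fun hdense hsum => not_dense_span_of_summable hmono.injective ha hsum hdense,
    dense_span_of_not_summable hmono.injective ha⟩
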